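/- Let G be a generic symmetric network congestion game on an extension-parallel graph with n players. For every k ∈ {1,…,n}, an outcome of G is a k-lookahead outcome if and only if it is a Nash equilibrium. Consequently k-LPoA(G) = PoA(G) for every k ∈ {1,…,n}. -/

import Mathlib

/-- A congestion game with `n` players on a finite resource type `R`:
each player has a finite set of actions (each action a set of resources),
and each resource has a delay function `ℕ → ℝ`. -/
structure CGame (R : Type) [DecidableEq R] [Fintype R] (n : ℕ) where
  actions : Fin n → Finset (Finset R)
  delay : R → ℕ → ℝ

namespace CGame

variable {R : Type} [DecidableEq R] [Fintype R] {n : ℕ}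

/-- The congestion `x(A)_r`: number of players using resource `r` in profile `A`. -/
def congestion (_G : CGame R n) (A : Fin n → Finset R) (r : R) : ℕ :=
  (Finset.univ.filter fun i => r ∈ A i).card

/-- The cost of player `i` in profile `A`. -/
def cost (G : CGame R n) (A : Fin n → Finset R) (i : Fin n) : ℝ :=
  ∑ r ∈ A i, G.delay r (G.congestion A r)

/-- `A` is an outcome: each player plays one of his actions. -/
def IsOutcome (G : CGame R n) (A : Fin n → Finset R) : Prop :=
  ∀ i, A i ∈ G.actions i

/-- `A` is a (pure) Nash equilibrium. -/
def IsNash (G : CGame R n) (A : Fin n → Finset R) : Prop :=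
  G.IsOutcome A ∧ ∀ i, ∀ B ∈ G.actions i, G.cost A i ≤ G.cost (Function.update A i B) i

/-- The subgame induced by the first player playing `a`. -/
def subgame (G : CGame R (n + 1)) (a : Finset R) : CGame R n where
  actions := fun i => G.actions i.succ
  delay := fun r y => G.delay r (y + if r ∈ a then 1 else 0)

/-- The subgame induced by the first `m` players playing `P`. -/
def subgameMany {m k : ℕ} (G : CGame R (m + k)) (P : Fin m → Finset R) : CGame R k where
  actions := fun i => G.actions (Fin.natAdd m i)
  delay := fun r y => G.delay r (y + (Finset.univ.filter fun i : Fin m => r ∈ P i).card)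

/-- `G^k`: the game on the first `min k n` players. -/
def truncate (G : CGame R n) (k : ℕ) : CGame R (min k n) where
  actions := fun i => G.actions (Fin.castLE (min_le_right k n) i)
  delay := G.delay

/-- The game reordered so that the player in position `i` is player `σ i`. -/
def reorder (G : CGame R n) (σ : Equiv.Perm (Fin n)) : CGame R n where
  actions := fun i => G.actions (σ i)
  delay := G.delay

/-- Subgame-perfect outcomes with respect to the order `1, …, n`. -/
def IsSPO : {n : ℕ} → CGame R n → (Fin n → Finset R) → Prop
  | 0, _, _ => True
  | _ + 1, G, A =>
      A 0 ∈ G.actions 0 ∧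
      ∃ f : Finset R → (Fin _ → Finset R),
        (∀ a ∈ G.actions 0, IsSPO (G.subgame a) (f a)) ∧
        f (A 0) = Fin.tail A ∧
        ∀ a ∈ G.actions 0,
          G.cost (Fin.cons (A 0) (f (A 0))) 0 ≤ G.cost (Fin.cons a (f a)) 0

/-- `k`-lookahead outcomes with respect to the order `1, …, n`. -/
def IsKLA (k : ℕ) : {n : ℕ} → CGame R n → (Fin n → Finset R) → Prop
  | 0, _, _ => True
  | n + 1, G, A =>
      (∃ (hk : 0 < min k (n + 1)) (B : Fin (min k (n + 1)) → Finset R),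
          IsSPO (G.truncate k) B ∧ B ⟨0, hk⟩ = A 0) ∧
      IsKLA k (G.subgame (A 0)) (Fin.tail A)

/-- `A` is a subgame-perfect outcome of `G` with respect to some order of the players. -/
def IsSPOutcome (G : CGame R n) (A : Fin n → Finset R) : Prop :=
  ∃ σ : Equiv.Perm (Fin n), IsSPO (G.reorder σ) (A ∘ σ)

/-- `A` is a `k`-lookahead outcome of `G` with respect to some order of the players. -/
def IsKLO (k : ℕ) (G : CGame R n) (A : Fin n → Finset R) : Prop :=
  ∃ σ : Equiv.Perm (Fin n), IsKLA k (G.reorder σ) (A ∘ σ)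

/-- The cost of player `i` when only the players in `s` play (profile restricted to `s`). -/
def costOn (G : CGame R n) (s : Finset (Fin n)) (A : Fin n → Finset R) (i : Fin n) : ℝ :=
  ∑ r ∈ A i, G.delay r ((s.filter fun j => r ∈ A j).card)

/-- `G` is generic: in every restriction of the game to a subset of the players,
a player's cost changes whenever his own action changes. -/
def Generic (G : CGame R n) : Prop :=
  ∀ s : Finset (Fin n), ∀ A B : Fin n → Finset R,
    (∀ i ∈ s, A i ∈ G.actions i) → (∀ i ∈ s, B i ∈ G.actions i) →
    ∀ j ∈ s, A j ≠ B j → G.costOn s A j ≠ G.costOn s B j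

/-- Utilitarian social cost. -/
def SC (G : CGame R n) (A : Fin n → Finset R) : ℝ :=
  ∑ i, G.cost A i

/-- Minimum social cost over all outcomes. -/
noncomputable def optSC (G : CGame R n) : ℝ :=
  sInf {y | ∃ A, G.IsOutcome A ∧ y = G.SC A}

/-- The `k`-Lookahead Price of Anarchy. -/
noncomputable def kLPoA (G : CGame R n) (k : ℕ) : ℝ :=
  sSup {y | ∃ A, IsKLO k G A ∧ y = G.SC A / G.optSC}

/-- The Price of Anarchy. -/
noncomputable def PoA (G : CGame R n) : ℝ :=
  sSup {y | ∃ A, G.IsNash A ∧ y = G.SC A / G.optSC}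

/-- Opportunity cost `O_A` of an outcome `A` in a symmetric game with action set `𝒜`. -/
noncomputable def oppCost (G : CGame R n) (𝒜 : Finset (Finset R)) (A : Fin n → Finset R) : ℝ :=
  sInf {y | ∃ P ∈ 𝒜, y = ∑ r ∈ P, G.delay r (G.congestion A r + 1)}

/-- Worst cost (egalitarian social cost) `W_A` of an outcome `A`. -/
noncomputable def worstCost (G : CGame R n) (A : Fin n → Finset R) : ℝ :=
  sSup {y | ∃ i, y = G.cost A i}

/-- Rosenthal's potential function. -/
def potential (G : CGame R n) (A : Fin n → Finset R) : ℝ :=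
  ∑ r : R, ∑ i ∈ Finset.Icc 1 (G.congestion A r), G.delay r i

end CGame
/-- Syntax trees of extension-parallel graphs: a single arc; parallel composition;
series composition of a single arc with an EP graph (arc first or arc last). -/
inductive EPTree : Type
  | edge : EPTree
  | parallel : EPTree → EPTree → EPTree
  | extHead : EPTree → EPTree
  | extTail : EPTree → EPTree

namespace EPTree

/-- The arcs of an extension-parallel graph. -/
def Arc : EPTree → Type
  | edge => Unit
  | parallel t₁ t₂ => t₁.Arc ⊕ t₂.Arc
  | extHead t => Unit ⊕ t.Arc
  | extTail t => t.Arc ⊕ Unit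

def arcDecEq : (t : EPTree) → DecidableEq t.Arc
  | edge => inferInstanceAs (DecidableEq Unit)
  | parallel t₁ t₂ =>
      letI := t₁.arcDecEq; letI := t₂.arcDecEq
      inferInstanceAs (DecidableEq (t₁.Arc ⊕ t₂.Arc))
  | extHead t =>
      letI := t.arcDecEq
      inferInstanceAs (DecidableEq (Unit ⊕ t.Arc))
  | extTail t =>
      letI := t.arcDecEq
      inferInstanceAs (DecidableEq (t.Arc ⊕ Unit))

instance (t : EPTree) : DecidableEq t.Arc := t.arcDecEq

def arcFintype : (t : EPTree) → Fintype t.Arc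
  | edge => inferInstanceAs (Fintype Unit)
  | parallel t₁ t₂ =>
      letI := t₁.arcFintype; letI := t₂.arcFintype
      inferInstanceAs (Fintype (t₁.Arc ⊕ t₂.Arc))
  | extHead t =>
      letI := t.arcFintype
      inferInstanceAs (Fintype (Unit ⊕ t.Arc))
  | extTail t =>
      letI := t.arcFintype
      inferInstanceAs (Fintype (t.Arc ⊕ Unit))

instance (t : EPTree) : Fintype t.Arc := t.arcFintype

/-- The set of arc sets of directed `o`–`d` paths of an extension-parallel graph. -/
def paths : (t : EPTree) → Finset (Finset t.Arc)
  | edge => {(Finset.univ : Finset Unit)}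
  | parallel t₁ t₂ =>
      (t₁.paths.image fun P => P.image Sum.inl) ∪ (t₂.paths.image fun P => P.image Sum.inr)
  | extHead t => t.paths.image fun P => insert (Sum.inl ()) (P.image Sum.inr)
  | extTail t => t.paths.image fun P => insert (Sum.inr ()) (P.image Sum.inl)

end EPTree

/-- Syntax trees of series-parallel graphs: a single arc; series composition;
parallel composition. -/
inductive SPTree : Type
  | edge : SPTree
  | series : SPTree → SPTree → SPTree
  | parallel : SPTree → SPTree → SPTree

namespace SPTree

/-- The arcs of a series-parallel graph. -/
def Arc : SPTree → Type
  | edge => Unit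
  | series t₁ t₂ => t₁.Arc ⊕ t₂.Arc
  | parallel t₁ t₂ => t₁.Arc ⊕ t₂.Arc

def arcDecEq : (t : SPTree) → DecidableEq t.Arc
  | edge => inferInstanceAs (DecidableEq Unit)
  | series t₁ t₂ =>
      letI := t₁.arcDecEq; letI := t₂.arcDecEq
      inferInstanceAs (DecidableEq (t₁.Arc ⊕ t₂.Arc))
  | parallel t₁ t₂ =>
      letI := t₁.arcDecEq; letI := t₂.arcDecEq
      inferInstanceAs (DecidableEq (t₁.Arc ⊕ t₂.Arc))

instance (t : SPTree) : DecidableEq t.Arc := t.arcDecEq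

def arcFintype : (t : SPTree) → Fintype t.Arc
  | edge => inferInstanceAs (Fintype Unit)
  | series t₁ t₂ =>
      letI := t₁.arcFintype; letI := t₂.arcFintype
      inferInstanceAs (Fintype (t₁.Arc ⊕ t₂.Arc))
  | parallel t₁ t₂ =>
      letI := t₁.arcFintype; letI := t₂.arcFintype
      inferInstanceAs (Fintype (t₁.Arc ⊕ t₂.Arc))

instance (t : SPTree) : Fintype t.Arc := t.arcFintype

/-- The set of arc sets of directed `o`–`d` paths of a series-parallel graph. -/
def paths : (t : SPTree) → Finset (Finset t.Arc)
  | edge => {(Finset.univ : Finset Unit)}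
  | series t₁ t₂ =>
      (t₁.paths ×ˢ t₂.paths).image fun p => p.1.image Sum.inl ∪ p.2.image Sum.inr
  | parallel t₁ t₂ =>
      (t₁.paths.image fun P => P.image Sum.inl) ∪ (t₂.paths.image fun P => P.image Sum.inr)

/-- A series-parallel graph is extension-parallel if in every series composition one of
the two parts is a single arc. -/
def IsEP : SPTree → Prop
  | edge => True
  | series t₁ t₂ => (t₁ = edge ∧ t₂.IsEP) ∨ (t₂ = edge ∧ t₁.IsEP)
  | parallel t₁ t₂ => t₁.IsEP ∧ t₂.IsEP

end SPTree

/-- The symmetric network congestion game with `n` players on an extension-parallel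
graph `t` with delay functions `d`. -/
def SNCGep (t : EPTree) (d : t.Arc → ℕ → ℝ) (n : ℕ) : CGame t.Arc n where
  actions := fun _ => t.paths
  delay := d

/-- The symmetric network congestion game with `n` players on a series-parallel
graph `t` with delay functions `d`. -/
def SNCGsp (t : SPTree) (d : t.Arc → ℕ → ℝ) (n : ℕ) : CGame t.Arc n where
  actions := fun _ => t.paths
  delay := d

namespace CGame

variable {R : Type} [DecidableEq R]

/-- The cost of a player who plays `P` while the actions of the other players form the
multiset `S`. -/
def joinCost (d : R → ℕ → ℝ) (P : Finset R) (S : Multiset (Finset R)) : ℝ :=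
  ∑ r ∈ P, d r (S.countP (r ∈ ·) + 1)

/-- The extra cost on the resources in `E`, each used once more than in `S`, caused by one
additional user. -/
def increment (d : R → ℕ → ℝ) (E : Finset R) (S : Multiset (Finset R)) : ℝ :=
  ∑ r ∈ E, (d r (S.countP (r ∈ ·) + 2) - d r (S.countP (r ∈ ·) + 1))

/-- The delay functions once an additional player has committed to `a`. -/
def shiftDelay (d : R → ℕ → ℝ) (a : Finset R) : R → ℕ → ℝ :=
  fun r y => d r (y + if r ∈ a then 1 else 0)

/-- Nash equilibria of a symmetric game, as multisets of actions. -/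
def IsNashMultiset (d : R → ℕ → ℝ) (𝓟 : Finset (Finset R)) (S : Multiset (Finset R)) : Prop :=
  (∀ P ∈ S, P ∈ 𝓟) ∧
    ∀ P S', S = P ::ₘ S' → ∀ Q ∈ 𝓟, joinCost d P S' ≤ joinCost d Q S'

/-- Genericity of a symmetric game, for multisets of at most `m` actions. -/
def IsGenericUpTo (d : R → ℕ → ℝ) (𝓟 : Finset (Finset R)) (m : ℕ) : Prop :=
  ∀ S T : Multiset (Finset R), (∀ P ∈ S, P ∈ 𝓟) → (∀ P ∈ T, P ∈ 𝓟) →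
    S.card = T.card → S.card < m →
    ∀ P ∈ 𝓟, ∀ Q ∈ 𝓟, joinCost d P S = joinCost d Q T → P = Q

/-- Intersections of members of the family behave like those of root-to-leaf paths of a tree. -/
def IsTreeLike {α : Type*} (𝓟 : Finset (Finset α)) : Prop :=
  ∀ P ∈ 𝓟, ∀ Q ∈ 𝓟, ∀ T ∈ 𝓟,
    (∀ r, r ∈ P → r ∈ T → r ∈ Q) ∨ ∀ r, r ∈ Q → (r ∈ P ↔ r ∈ T)

theorem IsTreeLike.inter {𝓟 : Finset (Finset R)} (ht : IsTreeLike 𝓟) :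
    ∀ P ∈ 𝓟, ∀ Q ∈ 𝓟, ∀ T ∈ 𝓟, P ∩ T ⊆ Q ∨ P ∩ Q = T ∩ Q := by
  simpa [IsTreeLike, Finset.subset_iff, Finset.ext_iff] using ht

section TreeLike

variable {α β : Type*} [DecidableEq (α ⊕ β)] [DecidableEq (Finset (α ⊕ β))]
  {𝓟 : Finset (Finset α)} {𝓠 : Finset (Finset β)}

theorem IsTreeLike.disjSum (h₁ : IsTreeLike 𝓟) (h₂ : IsTreeLike 𝓠) :
    IsTreeLike ((𝓟.image fun P => P.image (Sum.inl : α → α ⊕ β)) ∪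
      (𝓠.image fun P => P.image (Sum.inr : β → α ⊕ β))) := by
  intro P hP Q hQ T hT
  simp only [Finset.mem_union, Finset.mem_image] at hP hQ hT
  rcases hP with ⟨P, hP, rfl⟩ | ⟨P, hP, rfl⟩ <;>
  rcases hQ with ⟨Q, hQ, rfl⟩ | ⟨Q, hQ, rfl⟩ <;>
  rcases hT with ⟨T, hT, rfl⟩ | ⟨T, hT, rfl⟩ <;>
  simp
  · exact (h₁ P hP Q hQ T hT).imp_left fun h r hr s hs e => h r hr (e ▸ hs)
  · exact (h₂ P hP Q hQ T hT).imp_left fun h r hr s hs e => h r hr (e ▸ hs)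

theorem IsTreeLike.insert_inl (h : IsTreeLike 𝓠) (a : α) :
    IsTreeLike (𝓠.image fun P => insert (Sum.inl a : α ⊕ β) (P.image (Sum.inr : β → α ⊕ β))) := by
  intro P hP Q hQ T hT
  simp only [Finset.mem_image] at hP hQ hT
  obtain ⟨P, hP, rfl⟩ := hP
  obtain ⟨Q, hQ, rfl⟩ := hQ
  obtain ⟨T, hT, rfl⟩ := hT
  simpa using h P hP Q hQ T hT

theorem IsTreeLike.insert_inr (h : IsTreeLike 𝓟) (b : β) :
    IsTreeLike (𝓟.image fun P => insert (Sum.inr b : α ⊕ β) (P.image (Sum.inl : α → α ⊕ β))) := by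
  intro P hP Q hQ T hT
  simp only [Finset.mem_image] at hP hQ hT
  obtain ⟨P, hP, rfl⟩ := hP
  obtain ⟨Q, hQ, rfl⟩ := hQ
  obtain ⟨T, hT, rfl⟩ := hT
  simpa using h P hP Q hQ T hT

end TreeLike

section Multiset

variable {d : R → ℕ → ℝ} {𝓟 : Finset (Finset R)} {S T : Multiset (Finset R)}
  {P Q a : Finset R} {m : ℕ}

theorem joinCost_cons (d : R → ℕ → ℝ) (P Q : Finset R) (S : Multiset (Finset R)) :
    joinCost d P (Q ::ₘ S) = joinCost d P S + increment d (P ∩ Q) S := by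
  simp only [joinCost, increment, ← Finset.filter_mem_eq_inter, Finset.sum_filter,
    ← Finset.sum_add_distrib, Multiset.countP_cons]
  refine Finset.sum_congr rfl fun r _ => ?_
  by_cases h : r ∈ Q <;> simp [h, add_assoc]

theorem increment_mono (hd : ∀ r, Monotone (d r)) {E F : Finset R} (h : E ⊆ F)
    (S : Multiset (Finset R)) : increment d E S ≤ increment d F S :=
  Finset.sum_le_sum_of_subset_of_nonneg h fun r _ _ => sub_nonneg.2 (hd r (by omega))

theorem joinCost_shiftDelay (d : R → ℕ → ℝ) (a P : Finset R) (S : Multiset (Finset R)) :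
    joinCost (shiftDelay d a) P S = joinCost d P (a ::ₘ S) := by
  simp only [joinCost, shiftDelay, Multiset.countP_cons]
  exact Finset.sum_congr rfl fun r _ => by congr 1; omega

theorem monotone_shiftDelay (hd : ∀ r, Monotone (d r)) (a : Finset R) (r : R) :
    Monotone (shiftDelay d a r) :=
  fun _ _ h => hd r (Nat.add_le_add_right h _)

theorem IsGenericUpTo.mono (h : IsGenericUpTo d 𝓟 m) {k : ℕ} (hk : k ≤ m) :
    IsGenericUpTo d 𝓟 k :=
  fun S T hS hT hc hm => h S T hS hT hc (hm.trans_le hk)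

theorem IsGenericUpTo.shiftDelay (h : IsGenericUpTo d 𝓟 (m + 1)) (ha : a ∈ 𝓟) :
    IsGenericUpTo (shiftDelay d a) 𝓟 m := by
  intro S T hS hT hc hm P hP Q hQ he
  rw [joinCost_shiftDelay, joinCost_shiftDelay] at he
  refine h (a ::ₘ S) (a ::ₘ T) ?_ ?_ (by simpa using hc) (by simpa using hm) P hP Q hQ he
  · simpa [ha] using hS
  · simpa [ha] using hT

theorem IsNashMultiset.zero : IsNashMultiset d 𝓟 0 :=
  ⟨by simp, fun P S' h => absurd h.symm Multiset.cons_ne_zero⟩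

/-- Once one player has committed to his equilibrium action, the others still are in
equilibrium. -/
theorem IsNashMultiset.shiftDelay (h : IsNashMultiset d 𝓟 (a ::ₘ S)) :
    IsNashMultiset (shiftDelay d a) 𝓟 S := by
  refine ⟨fun P hP => h.1 P (Multiset.mem_cons_of_mem hP), ?_⟩
  rintro P S' rfl Q hQ
  rw [joinCost_shiftDelay, joinCost_shiftDelay]
  exact h.2 P (a ::ₘ S') (Multiset.cons_swap _ _ _) Q hQ

/-- A best response to an equilibrium extends it to an equilibrium. -/
theorem IsNashMultiset.cons (hd : ∀ r, Monotone (d r)) (ht : IsTreeLike 𝓟)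
    (h : IsNashMultiset d 𝓟 S) (ha : a ∈ 𝓟)
    (hbest : ∀ Q ∈ 𝓟, joinCost d a S ≤ joinCost d Q S) : IsNashMultiset d 𝓟 (a ::ₘ S) := by
  refine ⟨by simpa [ha] using h.1, fun P S' hS Q hQ => ?_⟩
  rcases Multiset.cons_eq_cons.1 hS with ⟨rfl, rfl⟩ | ⟨-, U, rfl, rfl⟩
  · exact hbest Q hQ
  have hP : P ∈ 𝓟 := h.1 P (Multiset.mem_cons_self _ _)
  have h1 := h.2 P U rfl Q hQ
  have h2 := h.2 P U rfl a ha
  have h3 := hbest Q hQ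
  simp only [joinCost_cons] at h3 ⊢
  rcases ht.inter P hP Q hQ a ha with h4 | h4
  · have h5 := increment_mono hd (Finset.subset_inter h4 Finset.inter_subset_right) U
    linarith
  · rw [Finset.inter_comm Q P, h4, Finset.inter_comm a P, Finset.inter_comm a Q] at h3
    linarith

/-- Removing a player with the largest cost from an equilibrium leaves an equilibrium. -/
theorem IsNashMultiset.exists_cons (hd : ∀ r, Monotone (d r)) (ht : IsTreeLike 𝓟)
    (h : IsNashMultiset d 𝓟 S) (hS : S ≠ 0) :
    ∃ P S', S = P ::ₘ S' ∧ IsNashMultiset d 𝓟 S' := by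
  obtain ⟨P, hPS, hmax⟩ := S.toFinset.exists_max_image (fun P => joinCost d P (S.erase P))
    (by simpa [Finset.nonempty_iff_ne_empty] using hS)
  rw [Multiset.mem_toFinset] at hPS
  obtain ⟨S', rfl⟩ := Multiset.exists_cons_of_mem hPS
  refine ⟨P, S', rfl, fun Q hQ => h.1 Q (Multiset.mem_cons_of_mem hQ), ?_⟩
  rintro T U rfl Q hQ
  have hP : P ∈ 𝓟 := h.1 P hPS
  have hT : T ∈ 𝓟 := h.1 T (by simp)
  have h1 := hmax T (by simp)
  rw [Multiset.cons_swap, Multiset.erase_cons_head, Multiset.cons_swap,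
    Multiset.erase_cons_head] at h1
  have h2 := h.2 P (T ::ₘ U) rfl Q hQ
  have h3 := h.2 T (P ::ₘ U) (Multiset.cons_swap _ _ _) Q hQ
  simp only [joinCost_cons] at h1 h2 h3
  rcases ht.inter Q hQ T hT P hP with h4 | h4
  · have h5 := increment_mono hd (Finset.subset_inter h4 Finset.inter_subset_right) U
    linarith
  · rw [h4] at h2
    rw [Finset.inter_comm T P] at h1
    linarith

/-- A generic game has only one equilibrium, up to permuting the players. -/
theorem IsNashMultiset.unique (hd : ∀ r, Monotone (d r)) (ht : IsTreeLike 𝓟)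
    (hg : IsGenericUpTo d 𝓟 m) (hS : IsNashMultiset d 𝓟 S) (hT : IsNashMultiset d 𝓟 T)
    (hcard : S.card = T.card) (hm : S.card ≤ m) : S = T := by
  induction hn : S.card generalizing S T with
  | zero =>
    rw [hn] at hcard
    rw [Multiset.card_eq_zero.1 hn, Multiset.card_eq_zero.1 hcard.symm]
  | succ j ih =>
    obtain ⟨P, S', rfl, hS'⟩ := hS.exists_cons hd ht (by rintro rfl; simp at hn)
    obtain ⟨Q, T', rfl, hT'⟩ := hT.exists_cons hd ht (by rintro rfl; simp at hcard)
    simp only [Multiset.card_cons, Nat.add_right_cancel_iff] at hcard hm hn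
    obtain rfl := ih hS' hT' hcard (by omega) hn
    have hP : P ∈ 𝓟 := hS.1 P (by simp)
    have hQ : Q ∈ 𝓟 := hT.1 Q (by simp)
    rw [hg S' S' hS'.1 hS'.1 rfl (by omega) P hP Q hQ
      (le_antisymm (hS.2 P S' rfl Q hQ) (hT.2 Q S' rfl P hP))]

/-- Whatever action a player commits to, the equilibrium of the remaining players is obtained
from the equilibrium of the whole game by deleting one action. -/
theorem IsNashMultiset.exists_eq_cons (hd : ∀ r, Monotone (d r)) (ht : IsTreeLike 𝓟)
    (hg : IsGenericUpTo d 𝓟 m) (ha : a ∈ 𝓟) (hS : IsNashMultiset d 𝓟 S)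
    (hT : IsNashMultiset (CGame.shiftDelay d a) 𝓟 T) (hcard : S.card = T.card + 1)
    (hm : S.card ≤ m) : ∃ z, S = z ::ₘ T := by
  induction hn : T.card generalizing S T with
  | zero =>
    obtain rfl := Multiset.card_eq_zero.1 hn
    exact Multiset.card_eq_one.1 hcard
  | succ j ih =>
    obtain ⟨p, U, rfl, hU⟩ := hT.exists_cons (monotone_shiftDelay hd a) ht
      (by rintro rfl; simp at hn)
    obtain ⟨b, V, rfl, hV⟩ := hS.exists_cons hd ht (by rintro rfl; simp at hcard)
    simp only [Multiset.card_cons, Nat.add_right_cancel_iff] at hcard hm hn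
    obtain ⟨z, rfl⟩ := ih hV hU hcard (by omega) hn
    simp only [Multiset.card_cons] at hm
    have hp : p ∈ 𝓟 := hT.1 p (by simp)
    have hb : b ∈ 𝓟 := hS.1 b (by simp)
    have hz : z ∈ 𝓟 := hV.1 z (by simp)
    by_cases hpb : p = b
    · exact ⟨z, by rw [hpb, Multiset.cons_swap]⟩
    by_cases hpz : p = z
    · exact ⟨b, by rw [hpz]⟩
    exfalso
    have hz1 := hV.2 z U rfl p hp
    have hz2 := hV.2 z U rfl b hb
    have hb1 := hS.2 b (z ::ₘ U) rfl p hp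
    have hlt {q : Finset R} (hq : q ∈ 𝓟) (hpq : p ≠ q) :
        joinCost d p (a ::ₘ U) < joinCost d q (a ::ₘ U) := by
      have hle := hT.2 p U rfl q hq
      rw [joinCost_shiftDelay, joinCost_shiftDelay] at hle
      refine hle.lt_of_ne fun he => hpq (hg (a ::ₘ U) (a ::ₘ U)
        (by simpa [ha] using hU.1) (by simpa [ha] using hU.1) rfl
        (by simp; omega) p hp q hq he)
    have hpb' := hlt hb hpb
    have hpz' := hlt hz hpz
    simp only [joinCost_cons] at hb1 hpb' hpz'
    rcases ht.inter z hz p hp a ha with h | h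
    · have := increment_mono hd (Finset.subset_inter h Finset.inter_subset_right) U
      linarith
    rw [Finset.inter_comm p z, h, Finset.inter_comm a p] at hb1
    rcases ht.inter b hb z hz a ha with h' | h'
    · have := increment_mono hd (Finset.subset_inter Finset.inter_subset_left h') U
      linarith
    rw [h', Finset.inter_comm a z] at hb1
    linarith

/-- Every equilibrium can be extended to an equilibrium with more players. -/
theorem IsNashMultiset.exists_ge (hd : ∀ r, Monotone (d r)) (ht : IsTreeLike 𝓟)
    (hne : 𝓟.Nonempty) (hS : IsNashMultiset d 𝓟 S) {j : ℕ} (hj : S.card ≤ j) :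
    ∃ T, IsNashMultiset d 𝓟 T ∧ T.card = j ∧ S ≤ T := by
  induction j, hj using Nat.le_induction with
  | base => exact ⟨S, hS, rfl, le_rfl⟩
  | succ j _ ih =>
    obtain ⟨T, hT, rfl, hST⟩ := ih
    obtain ⟨a, ha, hbest⟩ := 𝓟.exists_min_image (joinCost d · T) hne
    exact ⟨a ::ₘ T, hT.cons hd ht ha hbest, by simp, hST.trans (Multiset.le_cons_self _ _)⟩

end Multiset

section Profile

variable {α : Type*} {n : ℕ}

theorem map_val_eq_cons {s : Finset (Fin n)} {i : Fin n} (hi : i ∈ s)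
    (A : Fin n → α) : s.val.map A = A i ::ₘ (s.erase i).val.map A := by
  rw [← Multiset.map_cons, Finset.erase_val, Multiset.cons_erase hi]

theorem map_univ_eq_cons (A : Fin (n + 1) → α) :
    Finset.univ.val.map A = A 0 ::ₘ Finset.univ.val.map (Fin.tail A) := by
  simp [Fin.univ_val_map, List.ofFn_succ, Fin.tail_def]

theorem map_univ_cons (a : α) (f : Fin n → α) :
    Finset.univ.val.map (Fin.cons a f : Fin (n + 1) → α) =
      a ::ₘ Finset.univ.val.map f := by
  rw [map_univ_eq_cons, Fin.cons_zero, Fin.tail_cons]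

theorem exists_perm_of_map_univ_eq {A B : Fin n → α}
    (h : Finset.univ.val.map A = Finset.univ.val.map B) :
    ∃ σ : Equiv.Perm (Fin n), B = A ∘ σ := by
  classical
  have e (x : α) : Nonempty ({i // B i = x} ≃ {i // A i = x}) := by
    refine ⟨Fintype.equivOfCardEq ?_⟩
    have hx := congrArg (Multiset.count x) h
    rw [Multiset.count_map, Multiset.count_map] at hx
    simp only [Fintype.card_subtype, Finset.card_def, Finset.filter_val, eq_comm (b := x)]
    exact hx.symm
  replace e (x : α) := (e x).some
  refine ⟨(Equiv.sigmaFiberEquiv B).symm.trans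
    ((Equiv.sigmaCongrRight e).trans (Equiv.sigmaFiberEquiv A)), funext fun i => ?_⟩
  exact (e (B i) ⟨i, rfl⟩).2.symm

end Profile

section Game

variable [Fintype R] {n : ℕ}

theorem costOn_eq_joinCost (G : CGame R n) {s : Finset (Fin n)} {i : Fin n} (hi : i ∈ s)
    (A : Fin n → Finset R) :
    G.costOn s A i = joinCost G.delay (A i) ((s.erase i).val.map A) := by
  refine Finset.sum_congr rfl fun r hr => ?_
  congr 1
  rw [Multiset.countP_map, ← Finset.filter_val, Finset.card_val, Finset.filter_erase,
    Finset.card_erase_add_one (by simp [hi, hr])]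

theorem cost_eq_joinCost (G : CGame R n) (A : Fin n → Finset R) (i : Fin n) :
    G.cost A i = joinCost G.delay (A i) ((Finset.univ.erase i).val.map A) :=
  G.costOn_eq_joinCost (Finset.mem_univ i) A

theorem cost_cons_zero (G : CGame R (n + 1)) (a : Finset R) (f : Fin n → Finset R) :
    G.cost (Fin.cons a f) 0 = joinCost G.delay a (Finset.univ.val.map f) := by
  rw [cost_eq_joinCost, Fin.cons_zero]
  congr 1
  have h := map_val_eq_cons (Finset.mem_univ 0) (Fin.cons a f : Fin (n + 1) → Finset R)
  rw [map_univ_cons, Fin.cons_zero] at h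
  exact ((Multiset.cons_inj_right _).1 h).symm

theorem isNash_iff_isNashMultiset (G : CGame R n) {𝓟 : Finset (Finset R)}
    (hG : ∀ i, G.actions i = 𝓟) (A : Fin n → Finset R) :
    G.IsNash A ↔ IsNashMultiset G.delay 𝓟 (Finset.univ.val.map A) := by
  have hupd (i : Fin n) (B : Finset R) : G.cost (Function.update A i B) i =
      joinCost G.delay B ((Finset.univ.erase i).val.map A) := by
    rw [cost_eq_joinCost, Function.update_self]
    congr 1
    refine Multiset.map_congr rfl fun j hj => Function.update_of_ne ?_ _ _
    exact Finset.ne_of_mem_erase (s := Finset.univ) hj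
  simp only [IsNash, IsOutcome, IsNashMultiset, hG, hupd]
  simp only [cost_eq_joinCost]
  refine and_congr (by simp) ⟨fun h P S' hS Q hQ => ?_, fun h i B hB => ?_⟩
  · have hP : P ∈ Finset.univ.val.map A := by simp [hS]
    obtain ⟨i, -, rfl⟩ := Multiset.mem_map.1 hP
    rw [map_val_eq_cons (Finset.mem_univ i), Multiset.cons_inj_right] at hS
    exact hS ▸ h i Q hQ
  · exact h _ _ (map_val_eq_cons (Finset.mem_univ i) A) B hB

theorem Generic.isGenericUpTo {G : CGame R n} {𝓟 : Finset (Finset R)}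
    (hG : ∀ i, G.actions i = 𝓟) (h : G.Generic) : IsGenericUpTo G.delay 𝓟 n := by
  intro S T hS hT hcard hm P hP Q hQ he
  obtain ⟨j, hj⟩ : ∃ j, S.card = j := ⟨_, rfl⟩
  have hjn : j + 1 ≤ n := by omega
  let e : Fin (j + 1) ↪ Fin n := Fin.castLEEmb hjn
  let s : Finset (Fin n) := Finset.univ.map e
  have hs : e 0 ∈ s := by simp [s]
  have key (P : Finset R) (S : Multiset (Finset R)) (hj : S.card = j) :
      ∃ A : Fin n → Finset R, A (e 0) = P ∧ s.val.map A = P ::ₘ S := by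
    induction S using Quotient.inductionOn with
    | h l =>
      obtain rfl : l.length = j := hj
      refine ⟨Function.extend e (Fin.cons P l.get) fun _ => ∅, ?_, ?_⟩
      · rw [e.injective.extend_apply, Fin.cons_zero]
      · rw [Finset.map_val, Multiset.map_map, Function.extend_comp e.injective, map_univ_cons,
          Fin.univ_val_map, List.ofFn_get]
        rfl
  have key' (P : Finset R) (hP : P ∈ 𝓟) (S : Multiset (Finset R)) (hS : ∀ P ∈ S, P ∈ 𝓟)
      (hj : S.card = j) : ∃ A : Fin n → Finset R, A (e 0) = P ∧
        (∀ i ∈ s, A i ∈ G.actions i) ∧ G.costOn s A (e 0) = joinCost G.delay P S := by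
    obtain ⟨A, hA, hAS⟩ := key P S hj
    refine ⟨A, hA, fun i hi => ?_, ?_⟩
    · have : A i ∈ P ::ₘ S := hAS ▸ Multiset.mem_map_of_mem A hi
      rw [hG]
      rcases Multiset.mem_cons.1 this with h | h
      · exact h ▸ hP
      · exact hS _ h
    · rw [map_val_eq_cons hs, hA, Multiset.cons_inj_right] at hAS
      rw [costOn_eq_joinCost G hs, hA, hAS]
  obtain ⟨A, hA, hA', hAc⟩ := key' P hP S hS hj
  obtain ⟨B, hB, hB', hBc⟩ := key' Q hQ T hT (hcard ▸ hj)
  by_contra hPQ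
  exact h s A B hA' hB' (e 0) hs (by rwa [hA, hB]) (by rw [hAc, hBc, he])

theorem exists_isSPO {G : CGame R n} (hG : ∀ i, (G.actions i).Nonempty) :
    ∃ A, IsSPO G A := by
  induction n with
  | zero => exact ⟨fun _ => ∅, trivial⟩
  | succ n ih =>
    choose f hf using fun a => ih (G := G.subgame a) fun i => hG i.succ
    obtain ⟨a, ha, hmin⟩ := (G.actions 0).exists_min_image
      (fun a => G.cost (Fin.cons a (f a)) 0) (hG 0)
    exact ⟨Fin.cons a (f a), ha, f, fun b _ => hf b, rfl, hmin⟩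

theorem exists_isKLA {k : ℕ} (hk : 1 ≤ k) {G : CGame R n} (hG : ∀ i, (G.actions i).Nonempty) :
    ∃ A, IsKLA k G A := by
  induction n with
  | zero => exact ⟨fun _ => ∅, trivial⟩
  | succ n ih =>
    have hk' : 0 < min k (n + 1) := by omega
    obtain ⟨B, hB⟩ := exists_isSPO (G := G.truncate k) fun i => hG _
    obtain ⟨A, hA⟩ := ih (G := G.subgame (B ⟨0, hk'⟩)) fun i => hG i.succ
    exact ⟨Fin.cons (B ⟨0, hk'⟩) A, ⟨hk', B, hB, rfl⟩, hA⟩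

theorem IsSPO.isNashMultiset {𝓟 : Finset (Finset R)} (ht : IsTreeLike 𝓟) (hne : 𝓟.Nonempty)
    {G : CGame R n} (hG : ∀ i, G.actions i = 𝓟) (hd : ∀ r, Monotone (G.delay r))
    (hg : IsGenericUpTo G.delay 𝓟 n) {A : Fin n → Finset R} (hA : IsSPO G A) :
    IsNashMultiset G.delay 𝓟 (Finset.univ.val.map A) := by
  induction n with
  | zero => simpa using IsNashMultiset.zero
  | succ n ih =>
    obtain ⟨ha, f, hf, hfA, hmin⟩ := hA
    simp only [hG, cost_cons_zero] at ha hf hmin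
    have hf' (a : Finset R) (h : a ∈ 𝓟) :
        IsNashMultiset (shiftDelay G.delay a) 𝓟 (Finset.univ.val.map (f a)) :=
      ih (G := G.subgame a) (fun i => hG i.succ) (monotone_shiftDelay hd a)
        (hg.shiftDelay h) (hf a h)
    obtain ⟨N, hN, hNc, -⟩ := IsNashMultiset.zero.exists_ge hd ht hne (Nat.zero_le (n + 1))
    obtain ⟨z, rfl⟩ := hN.exists_eq_cons hd ht hg ha (hf' _ ha) (by simp [hNc]) hNc.le
    have hz : z ∈ 𝓟 := hN.1 z (by simp)
    have hfz := (hf' z hz).unique (monotone_shiftDelay hd z) ht (hg.shiftDelay hz)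
      hN.shiftDelay (by simp) (by simp)
    have hle := hmin z hz
    rw [hfz] at hle
    have hfm : ∀ P ∈ Finset.univ.val.map (f (A 0)), P ∈ 𝓟 := (hf' _ ha).1
    have haz : A 0 = z := hg _ _ hfm hfm rfl (by simp) _ ha _ hz
      (le_antisymm hle (hN.2 z _ rfl _ ha))
    rw [map_univ_eq_cons, ← hfA, haz]
    rwa [haz] at hN

theorem IsKLA.isNashMultiset {𝓟 : Finset (Finset R)} (ht : IsTreeLike 𝓟) (hne : 𝓟.Nonempty)
    {k : ℕ} {G : CGame R n} (hG : ∀ i, G.actions i = 𝓟) (hd : ∀ r, Monotone (G.delay r))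
    (hg : IsGenericUpTo G.delay 𝓟 n) {A : Fin n → Finset R} (hA : IsKLA k G A) :
    IsNashMultiset G.delay 𝓟 (Finset.univ.val.map A) := by
  induction n with
  | zero => simpa using IsNashMultiset.zero
  | succ n ih =>
    obtain ⟨⟨hk, B, hB, hBA⟩, htail⟩ := hA
    have hB' : IsNashMultiset G.delay 𝓟 (Finset.univ.val.map B) :=
      hB.isNashMultiset ht hne (G := G.truncate k) (fun _ => hG _) hd
        (hg.mono (min_le_right _ _))
    have hmem : A 0 ∈ Finset.univ.val.map B := hBA ▸ Multiset.mem_map_of_mem B (by simp)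
    have ha : A 0 ∈ 𝓟 := hB'.1 _ hmem
    obtain ⟨N, hN, hNc, hBN⟩ := hB'.exists_ge hd ht hne (j := n + 1) (by simp)
    obtain ⟨N', rfl⟩ := Multiset.exists_cons_of_mem (Multiset.mem_of_le hBN hmem)
    have htail' := ih (G := G.subgame (A 0)) (fun i => hG i.succ) (monotone_shiftDelay hd _)
      (hg.shiftDelay ha) htail
    rw [map_univ_eq_cons, htail'.unique (monotone_shiftDelay hd _) ht (hg.shiftDelay ha)
      hN.shiftDelay (by simpa using hNc.symm) (by simp)]
    exact hN

/-- In a symmetric generic game with tree-like actions, the `k`-lookahead outcomes are the Nash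
equilibria. -/
theorem isKLO_iff_isNash {𝓟 : Finset (Finset R)} (ht : IsTreeLike 𝓟) (hne : 𝓟.Nonempty)
    {k : ℕ} (hk : 1 ≤ k) {G : CGame R n} (hG : ∀ i, G.actions i = 𝓟)
    (hd : ∀ r, Monotone (G.delay r)) (hg : G.Generic) (A : Fin n → Finset R) :
    IsKLO k G A ↔ G.IsNash A := by
  have hg' := hg.isGenericUpTo hG
  have hreorder (σ : Equiv.Perm (Fin n)) : G.reorder σ = G := by
    simp [reorder, hG, ← funext hG]
  simp only [IsKLO, hreorder, isNash_iff_isNashMultiset G hG]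
  constructor
  · rintro ⟨σ, hσ⟩
    have h := hσ.isNashMultiset ht hne hG hd hg'
    rwa [← Multiset.map_map, Multiset.map_univ_val_equiv] at h
  · intro h
    obtain ⟨B, hB⟩ := exists_isKLA hk (G := G) fun i => by rwa [hG]
    have hAB := h.unique hd ht hg' (hB.isNashMultiset ht hne hG hd hg') (by simp) (by simp)
    obtain ⟨σ, rfl⟩ := exists_perm_of_map_univ_eq hAB
    exact ⟨σ, hB⟩

end Game

end CGame

namespace EPTree

theorem paths_nonempty (t : EPTree) : t.paths.Nonempty := by
  induction t with
  | edge => exact Finset.singleton_nonempty _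
  | parallel t₁ t₂ h₁ h₂ => exact (h₁.image _).mono Finset.subset_union_left
  | extHead t h => exact h.image _
  | extTail t h => exact h.image _

theorem isTreeLike_paths (t : EPTree) : CGame.IsTreeLike t.paths := by
  induction t with
  | edge =>
    intro P hP Q hQ T hT
    obtain rfl := Finset.mem_singleton.1 hP
    obtain rfl := Finset.mem_singleton.1 hT
    exact Or.inr fun r _ => Iff.rfl
  | parallel t₁ t₂ h₁ h₂ => exact h₁.disjSum h₂
  | extHead t h => exact h.insert_inl ()
  | extTail t h => exact h.insert_inr ()

end EPTree

/-- For a generic symmetric network congestion game on an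
extension-parallel graph with `n` players and every `k ∈ {1,…,n}`, an outcome is a
`k`-lookahead outcome iff it is a Nash equilibrium; consequently the `k`-Lookahead
Price of Anarchy equals the Price of Anarchy. -/
theorem ep_generic_klookahead_iff_nash (t : EPTree) (d : t.Arc → ℕ → ℝ)
    (hmono : ∀ r, Monotone (d r)) (hnonneg : ∀ r m, 0 ≤ d r m)
    (n : ℕ) (hgen : CGame.Generic (SNCGep t d n))
    (k : ℕ) (hk1 : 1 ≤ k) (hkn : k ≤ n) :
    (∀ A, CGame.IsKLO k (SNCGep t d n) A ↔ CGame.IsNash (SNCGep t d n) A) ∧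
    CGame.kLPoA (SNCGep t d n) k = CGame.PoA (SNCGep t d n) := by
  have h := CGame.isKLO_iff_isNash t.isTreeLike_paths t.paths_nonempty hk1
    (G := SNCGep t d n) (fun _ => rfl) hmono hgen
  exact ⟨h, by simp only [CGame.kLPoA, CGame.PoA, h]⟩
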